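/- Let X be a CAT(0) space and let ω = ω₁·…·ω_m be a concatenation of geodesic segments such that at each breakpoint consecutive segments meet at Alexandrov angle greater than π − ε, where ε > 0. Then (for ε sufficiently small, by the Ballmann–Brin approximation lemma) the geodesic γ joining the endpoints of ω starts in a direction at angular distance less than (m−1)ε from the starting direction of ω₁, and ends in a direction at angular distance less than (m−1)ε from the ending direction of ω_m. -/

import Mathlib

open Filter Set Metric

/-- Euclidean comparison angle via the law of cosines. -/
noncomputable def compAngle (a b c : ℝ) : ℝ := Real.arccos ((a^2 + b^2 - c^2) / (2*a*b))

/-- `γ` is a unit-speed geodesic on the interval `[a,b]`. -/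
def IsGeodesicOn {X : Type*} [MetricSpace X] (γ : ℝ → X) (a b : ℝ) : Prop :=
  ∀ s ∈ Set.Icc a b, ∀ t ∈ Set.Icc a b, dist (γ s) (γ t) = |s - t|

/-- `γ` is a unit-speed geodesic line. -/
def IsGeodesicLine {X : Type*} [MetricSpace X] (γ : ℝ → X) : Prop :=
  ∀ s t : ℝ, dist (γ s) (γ t) = |s - t|

/-- `γ` is a local geodesic on `[a,b]`. -/
def IsLocalGeodesicOn {X : Type*} [MetricSpace X] (γ : ℝ → X) (a b : ℝ) : Prop :=
  ∀ s ∈ Set.Icc a b, ∃ ε > 0, IsGeodesicOn γ (max a (s - ε)) (min b (s + ε))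

/-- Every pair of points is joined by a unit-speed geodesic. -/
def GeodesicSpace (X : Type*) [MetricSpace X] : Prop :=
  ∀ x y : X, ∃ γ : ℝ → X, γ 0 = x ∧ γ (dist x y) = y ∧ IsGeodesicOn γ 0 (dist x y)

/-- CAT(0): geodesic space satisfying the CN (comparison) inequality. -/
def CAT0 (X : Type*) [MetricSpace X] : Prop :=
  GeodesicSpace X ∧
  ∀ x y z m : X, dist y m = dist y z / 2 → dist z m = dist y z / 2 →
    dist x m ^ 2 ≤ (dist x y ^ 2 + dist x z ^ 2) / 2 - dist y z ^ 2 / 4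

/-- The Alexandrov (upper) angle at the common start point between `γ` and `σ`
(both assumed to issue from the same point at parameter `0`). -/
noncomputable def alexAngle {X : Type*} [MetricSpace X] (γ σ : ℝ → X) : ℝ :=
  Filter.limsup (fun q : ℝ × ℝ => compAngle q.1 q.2 (dist (γ q.1) (σ q.2)))
    ((nhdsWithin 0 (Set.Ioi 0)) ×ˢ (nhdsWithin 0 (Set.Ioi 0)))

/-- `γ` (defined on `[0, L]`) eventually lies in `S` near its endpoint `L`. -/
def EndsIn {X : Type*} [MetricSpace X] (γ : ℝ → X) (L : ℝ) (S : Set X) : Prop :=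
  ∃ ε > 0, ∀ s : ℝ, L - ε < s → s < L → γ s ∈ S

/-- `γ` eventually lies in `S` near its start point. -/
def StartsIn {X : Type*} [MetricSpace X] (γ : ℝ → X) (S : Set X) : Prop :=
  ∃ ε > 0, ∀ s : ℝ, 0 < s → s < ε → γ s ∈ S

/-- `γ` is a unit-speed geodesic from `x` to `y` parametrised on `[0, dist x y]`. -/
def GeodesicFromTo {X : Type*} [MetricSpace X] (γ : ℝ → X) (x y : X) : Prop :=
  γ 0 = x ∧ γ (dist x y) = y ∧ IsGeodesicOn γ 0 (dist x y)

/-- `γ` (on `[0,L]`) ends at `η u` perpendicularly to the curve `η`. -/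
def EndsPerp {X : Type*} [MetricSpace X] (γ : ℝ → X) (L : ℝ) (η : ℝ → X) (u : ℝ) : Prop :=
  γ L = η u ∧ alexAngle (fun s => γ (L - s)) (fun s => η (u + s)) = Real.pi / 2 ∧
    alexAngle (fun s => γ (L - s)) (fun s => η (u - s)) = Real.pi / 2

/-- `γ` starts at `η u` perpendicularly to the curve `η`. -/
def StartsPerp {X : Type*} [MetricSpace X] (γ : ℝ → X) (η : ℝ → X) (u : ℝ) : Prop :=
  γ 0 = η u ∧ alexAngle γ (fun s => η (u + s)) = Real.pi / 2 ∧
    alexAngle γ (fun s => η (u - s)) = Real.pi / 2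

/-- Abstract data of a (piecewise Euclidean) triangle complex structure on a metric space:
edges and triangles with their interiors, edges being geodesically parametrised. -/
structure TriangleComplex (X : Type*) [MetricSpace X] where
  Edge : Type*
  Tri : Type*
  edgeSet : Edge → Set X
  triSet : Tri → Set X
  edgeInt : Edge → Set X
  triInt : Tri → Set X
  edgeParam : Edge → ℝ → X
  edgeLen : Edge → ℝ
  edgeParam_geodesic : ∀ e, IsGeodesicOn (edgeParam e) 0 (edgeLen e)
  edgeParam_maps : ∀ e, ∀ s ∈ Set.Icc (0:ℝ) (edgeLen e), edgeParam e s ∈ edgeSet e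
  edgeInt_sub : ∀ e, edgeInt e ⊆ edgeSet e
  triInt_sub : ∀ T, triInt T ⊆ triSet T

theorem nonpos_of_midpoint_convex {g : ℝ → ℝ} {a b : ℝ} (hg : ContinuousOn g (Icc a b))
    (hmid : ∀ s ∈ Icc a b, ∀ t ∈ Icc a b, g ((s + t) / 2) ≤ (g s + g t) / 2)
    (ha : g a ≤ 0) (hb : g b ≤ 0) : ∀ s ∈ Icc a b, g s ≤ 0 := by
  intro s hs
  obtain ⟨p, hp, hpmax⟩ := isCompact_Icc.exists_isMaxOn ⟨s, hs⟩ hg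
  by_contra! hpos
  have hMpos : 0 < g p := hpos.trans_le (hpmax hs)
  have hcomp : IsCompact (Icc a b ∩ g ⁻¹' {g p}) :=
    isCompact_Icc.of_isClosed_subset (hg.preimage_isClosed_of_isClosed isClosed_Icc
      isClosed_singleton) inter_subset_left
  obtain ⟨q, ⟨hq, hqM⟩, hqleast⟩ := hcomp.exists_isLeast ⟨p, hp, rfl⟩
  have hqM : g q = g p := hqM
  have haq : a < q := lt_of_le_of_ne hq.1 (by rintro rfl; linarith)
  have hqb : q < b := lt_of_le_of_ne hq.2 (by rintro rfl; linarith)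
  set δ := min (q - a) (b - q)
  have hδ : 0 < δ := lt_min (by linarith) (by linarith)
  have hδa : δ ≤ q - a := min_le_left _ _
  have hδb : δ ≤ b - q := min_le_right _ _
  have h₁ : q - δ ∈ Icc a b := ⟨by linarith, by linarith⟩
  have h₂ : q + δ ∈ Icc a b := ⟨by linarith, by linarith⟩
  have h := hmid _ h₁ _ h₂
  rw [show (q - δ + (q + δ)) / 2 = q by ring] at h
  have hle₁ : g (q - δ) ≤ g p := hpmax h₁
  have hle₂ : g (q + δ) ≤ g p := hpmax h₂
  have : q ≤ q - δ := hqleast ⟨h₁, show g (q - δ) = g p by linarith⟩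
  linarith

theorem IsGeodesicOn.continuousOn {X : Type*} [MetricSpace X] {γ : ℝ → X} {a b : ℝ}
    (h : IsGeodesicOn γ a b) : ContinuousOn γ (Icc a b) := by
  refine LipschitzOnWith.continuousOn (K := 1) (LipschitzOnWith.of_dist_le_mul ?_)
  intro s hs t ht
  simp [h s hs t ht, Real.dist_eq]

theorem IsGeodesicOn.reverse {X : Type*} [MetricSpace X] {γ : ℝ → X} {L : ℝ}
    (h : IsGeodesicOn γ 0 L) : IsGeodesicOn (fun s => γ (L - s)) 0 L := by
  intro s hs t ht
  rw [h _ ⟨by linarith [hs.2], by linarith [hs.1]⟩ _ ⟨by linarith [ht.2], by linarith [ht.1]⟩,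
    abs_sub_comm s t]
  congr 1
  ring

theorem IsGeodesicOn.dist_zero {X : Type*} [MetricSpace X] {γ : ℝ → X} {L s : ℝ}
    (h : IsGeodesicOn γ 0 L) (hs : s ∈ Icc 0 L) : dist (γ 0) (γ s) = s := by
  rw [h 0 ⟨le_rfl, hs.1.trans hs.2⟩ s hs, zero_sub, abs_neg, abs_of_nonneg hs.1]

/-- Stewart's inequality in a CAT(0) space. -/
theorem CAT0.stewart {X : Type*} [MetricSpace X] (hX : CAT0 X) {γ : ℝ → X} {L : ℝ}
    (hL : 0 < L) (h : IsGeodesicOn γ 0 L) (x : X) {s : ℝ} (hs : s ∈ Icc 0 L) :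
    dist x (γ s) ^ 2 ≤
      (1 - s / L) * dist x (γ 0) ^ 2 + s / L * dist x (γ L) ^ 2 - s * (L - s) := by
  have key := nonpos_of_midpoint_convex (a := 0) (b := L)
    (g := fun s => dist x (γ s) ^ 2 -
      ((1 - s / L) * dist x (γ 0) ^ 2 + s / L * dist x (γ L) ^ 2 - s * (L - s)))
    ?_ ?_ ?_ ?_ s hs
  · linarith
  · have := h.continuousOn
    fun_prop
  · intro s hs t ht
    have hm : (s + t) / 2 ∈ Icc 0 L :=
      ⟨by linarith [hs.1, ht.1], by linarith [hs.2, ht.2]⟩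
    have cn := hX.2 x (γ s) (γ t) (γ ((s + t) / 2))
      (by
        rw [h _ hs _ hm, h _ hs _ ht, show s - (s + t) / 2 = (s - t) / 2 by ring, abs_div]
        norm_num)
      (by
        rw [h _ ht _ hm, h _ hs _ ht, abs_sub_comm s t,
          show t - (s + t) / 2 = (t - s) / 2 by ring, abs_div]
        norm_num)
    rw [h _ hs _ ht, sq_abs] at cn
    have e : (s + t) / 2 / L = (s / L + t / L) / 2 := by ring
    rw [e]
    linarith
  · simp
  · simp [hL.ne']

theorem compAngle_nonneg (a b c : ℝ) : 0 ≤ compAngle a b c := Real.arccos_nonneg _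

theorem compAngle_le_pi (a b c : ℝ) : compAngle a b c ≤ Real.pi := Real.arccos_le_pi _

theorem compAngle_self_zero {a : ℝ} (ha : 0 < a) : compAngle a a 0 = 0 := by
  unfold compAngle
  rw [show (a ^ 2 + a ^ 2 - 0 ^ 2) / (2 * a * a) = 1 by field_simp; ring, Real.arccos_one]

theorem sq_lt_of_compAngle_lt {a b c α : ℝ} (ha : 0 < a) (hb : 0 < b) (h₀ : 0 ≤ α)
    (hπ : α ≤ Real.pi) (h : compAngle a b c < α) :
    c ^ 2 < a ^ 2 + b ^ 2 - 2 * a * b * Real.cos α := by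
  by_contra! hc
  refine h.not_ge ?_
  rw [← Real.arccos_cos h₀ hπ]
  refine Real.arccos_le_arccos ?_
  rw [div_le_iff₀ (by positivity)]
  linarith

theorem lt_sq_of_lt_compAngle {a b c α : ℝ} (ha : 0 < a) (hb : 0 < b) (h₀ : 0 ≤ α)
    (hπ : α ≤ Real.pi) (h : α < compAngle a b c) :
    a ^ 2 + b ^ 2 - 2 * a * b * Real.cos α < c ^ 2 := by
  by_contra! hc
  refine h.not_ge ?_
  rw [← Real.arccos_cos h₀ hπ]
  refine Real.arccos_le_arccos ?_
  rw [le_div_iff₀ (by positivity)]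
  linarith

theorem cos_compAngle {a b c : ℝ} (ha : 0 < a) (hb : 0 < b) (h₁ : c ≤ a + b) (h₂ : a ≤ b + c)
    (h₃ : b ≤ a + c) : Real.cos (compAngle a b c) = (a ^ 2 + b ^ 2 - c ^ 2) / (2 * a * b) := by
  have hc : 0 ≤ c := by linarith
  refine Real.cos_arccos ?_ ?_
  · rw [le_div_iff₀ (by positivity)]
    nlinarith
  · rw [div_le_iff₀ (by positivity)]
    nlinarith [mul_nonneg (sub_nonneg.2 h₂) (sub_nonneg.2 h₃)]

/-- The angles of a Euclidean triangle sum to `π`. -/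
theorem compAngle_add_add_le_pi {a b c : ℝ} (ha : 0 < a) (hb : 0 < b) (hc : 0 < c)
    (h₁ : c ≤ a + b) (h₂ : a ≤ b + c) (h₃ : b ≤ a + c) :
    compAngle a b c + compAngle a c b + compAngle b c a ≤ Real.pi := by
  have cA := cos_compAngle ha hb h₁ h₂ h₃
  have cB := cos_compAngle ha hc h₃ (by linarith) h₁
  have cC := cos_compAngle hb hc h₂ (by linarith) (by linarith)
  set A := compAngle a b c with hA
  set B := compAngle a c b with hB
  set C := compAngle b c a with hC
  have A0 : 0 ≤ A := compAngle_nonneg _ _ _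
  have Aπ : A ≤ Real.pi := compAngle_le_pi _ _ _
  have B0 : 0 ≤ B := compAngle_nonneg _ _ _
  have Bπ : B ≤ Real.pi := compAngle_le_pi _ _ _
  have C0 : 0 ≤ C := compAngle_nonneg _ _ _
  have Cπ : C ≤ Real.pi := compAngle_le_pi _ _ _
  have hAB : A + B ≤ Real.pi := by
    by_contra! h
    have hlt := Real.cos_lt_cos_of_nonneg_of_le_pi (by linarith) Aπ
      (show Real.pi - B < A by linarith)
    rw [Real.cos_pi_sub, cA, cB] at hlt
    have e : (a ^ 2 + b ^ 2 - c ^ 2) / (2 * a * b) + (a ^ 2 + c ^ 2 - b ^ 2) / (2 * a * c)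
        = (b + c) * ((a - (b - c)) * (a + (b - c))) / (2 * a * b * c) := by
      field_simp
      ring
    have : 0 ≤ (b + c) * ((a - (b - c)) * (a + (b - c))) / (2 * a * b * c) :=
      div_nonneg (mul_nonneg (by linarith) (mul_nonneg (by linarith) (by linarith)))
        (by positivity)
    linarith
  have sA := Real.sin_nonneg_of_nonneg_of_le_pi A0 Aπ
  have sB := Real.sin_nonneg_of_nonneg_of_le_pi B0 Bπ
  have hsin : Real.sin A * b = Real.sin B * c := by
    refine (sq_eq_sq₀ (by positivity) (by positivity)).1 ?_
    rw [mul_pow, mul_pow, Real.sin_sq, Real.sin_sq, cA, cB]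
    field_simp
    ring
  have hss : Real.sin A * Real.sin B = (1 - Real.cos A ^ 2) * b / c := by
    rw [← Real.sin_sq, eq_div_iff hc.ne']
    linear_combination (-Real.sin A) * hsin
  have hcos : Real.cos (A + B) = Real.cos (Real.pi - C) := by
    rw [Real.cos_pi_sub, Real.cos_add, hss, cA, cB, cC]
    field_simp
    ring
  have := Real.injOn_cos ⟨by linarith, hAB⟩ ⟨by linarith, by linarith⟩ hcos
  linarith

section Angle

variable {X : Type*} [MetricSpace X]

theorem isBoundedUnder_le_compAngle (γ σ : ℝ → X) (l : Filter (ℝ × ℝ)) :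
    IsBoundedUnder (· ≤ ·) l
      (fun q : ℝ × ℝ => compAngle q.1 q.2 (dist (γ q.1) (σ q.2))) :=
  isBoundedUnder_of ⟨Real.pi, fun _ => compAngle_le_pi _ _ _⟩

theorem isBoundedUnder_ge_compAngle (γ σ : ℝ → X) (l : Filter (ℝ × ℝ)) :
    IsBoundedUnder (· ≥ ·) l
      (fun q : ℝ × ℝ => compAngle q.1 q.2 (dist (γ q.1) (σ q.2))) :=
  isBoundedUnder_of ⟨0, fun _ => compAngle_nonneg _ _ _⟩

theorem alexAngle_nonneg (γ σ : ℝ → X) : 0 ≤ alexAngle γ σ :=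
  le_limsup_of_frequently_le (Frequently.of_forall fun _ => compAngle_nonneg _ _ _)
    (isBoundedUnder_le_compAngle γ σ _)

theorem alexAngle_le_pi (γ σ : ℝ → X) : alexAngle γ σ ≤ Real.pi :=
  limsup_le_of_le (isBoundedUnder_ge_compAngle γ σ _).isCoboundedUnder_le
    (Eventually.of_forall fun _ => compAngle_le_pi _ _ _)

theorem exists_forall_compAngle_lt {γ σ : ℝ → X} {α : ℝ} (h : alexAngle γ σ < α) :
    ∃ η > 0, ∀ s ∈ Ioo 0 η, ∀ t ∈ Ioo 0 η, compAngle s t (dist (γ s) (σ t)) < α := by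
  have ev := eventually_lt_of_limsup_lt h (isBoundedUnder_le_compAngle γ σ _)
  have hb := (nhdsGT_basis (0 : ℝ)).prod_self
  obtain ⟨η, hη, H⟩ := hb.eventually_iff.1 ev
  exact ⟨η, hη, fun s hs t ht => @H (s, t) ⟨hs, ht⟩⟩

theorem exists_lt_compAngle {γ σ : ℝ → X} {α : ℝ} (h : α < alexAngle γ σ) {η : ℝ} (hη : 0 < η) :
    ∃ s ∈ Ioo 0 η, ∃ t ∈ Ioo 0 η, α < compAngle s t (dist (γ s) (σ t)) := by
  have fr := frequently_lt_of_lt_limsup (isBoundedUnder_ge_compAngle γ σ _).isCoboundedUnder_le h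
  have hb := (nhdsGT_basis (0 : ℝ)).prod_self
  obtain ⟨⟨s, t⟩, ⟨hs, ht⟩, H⟩ := hb.frequently_iff.1 fr _ hη
  exact ⟨s, hs, t, ht, H⟩

/-- The ray from the origin splitting the angle `α + β` of a planar triangle into `α` and `β`
meets the opposite side, at distance `t` from the origin. -/
theorem exists_split_triangle {a b α β : ℝ} (ha : 0 < a) (hb : 0 < b) (hα : 0 < α) (hβ : 0 < β)
    (hαβ : α + β < Real.pi) :
    ∃ t, 0 < t ∧ t ≤ max a b ∧ ∃ u v : ℝ, 0 ≤ u ∧ 0 ≤ v ∧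
      u ^ 2 = a ^ 2 + t ^ 2 - 2 * a * t * Real.cos α ∧
      v ^ 2 = t ^ 2 + b ^ 2 - 2 * t * b * Real.cos β ∧
      (u + v) ^ 2 = a ^ 2 + b ^ 2 - 2 * a * b * Real.cos (α + β) := by
  have sα := Real.sin_pos_of_pos_of_lt_pi hα (by linarith)
  have sβ := Real.sin_pos_of_pos_of_lt_pi hβ (by linarith)
  have sαβ := Real.sin_pos_of_pos_of_lt_pi (add_pos hα hβ) hαβ
  have hD : 0 < a * Real.sin α + b * Real.sin β := by positivity
  have hN : 0 ≤ a ^ 2 + b ^ 2 - 2 * a * b * Real.cos (α + β) := by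
    nlinarith [sq_nonneg (a - b), Real.cos_le_one (α + β), mul_pos ha hb]
  set w := √(a ^ 2 + b ^ 2 - 2 * a * b * Real.cos (α + β)) with hw
  have hw0 : 0 ≤ w := Real.sqrt_nonneg _
  have hw2 : w ^ 2 = a ^ 2 + b ^ 2 - 2 * a * b * Real.cos (α + β) := Real.sq_sqrt hN
  have pα := Real.sin_sq_add_cos_sq α
  have pβ := Real.sin_sq_add_cos_sq β
  set D := a * Real.sin α + b * Real.sin β with hDdef
  refine ⟨a * b * Real.sin (α + β) / D, by positivity, ?_, a * Real.sin α / D * w,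
    b * Real.sin β / D * w, by positivity, by positivity, ?_, ?_, ?_⟩
  · rw [div_le_iff₀ hD, Real.sin_add]
    have hm : 0 ≤ max a b := ha.le.trans (le_max_left _ _)
    have h₁ : b * (a * Real.sin α) * Real.cos β ≤ max a b * (a * Real.sin α) := by
      calc b * (a * Real.sin α) * Real.cos β ≤ b * (a * Real.sin α) * 1 := by
            gcongr
            exact Real.cos_le_one β
        _ ≤ max a b * (a * Real.sin α) := by
            rw [mul_one]
            gcongr
            exact le_max_right _ _
    have h₂ : a * (b * Real.sin β) * Real.cos α ≤ max a b * (b * Real.sin β) := by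
      calc a * (b * Real.sin β) * Real.cos α ≤ a * (b * Real.sin β) * 1 := by
            gcongr
            exact Real.cos_le_one α
        _ ≤ max a b * (b * Real.sin β) := by
            rw [mul_one]
            gcongr
            exact le_max_left _ _
    rw [hDdef]
    linarith
  · rw [mul_pow, hw2]
    field_simp
    rw [hDdef, Real.sin_add, Real.cos_add]
    linear_combination (2 * Real.sin α * Real.sin β * a * b + b ^ 2 * Real.sin β ^ 2) * pα -
      b ^ 2 * Real.sin α ^ 2 * pβ
  · rw [mul_pow, hw2]
    field_simp
    rw [hDdef, Real.sin_add, Real.cos_add]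
    linear_combination (2 * Real.sin α * Real.sin β * a * b + a ^ 2 * Real.sin α ^ 2) * pβ -
      a ^ 2 * Real.sin β ^ 2 * pα
  · rw [← hw2, ← add_mul, ← add_div, ← hDdef, div_self hD.ne', one_mul]

theorem alexAngle_triangle (γ σ τ : ℝ → X) :
    alexAngle γ τ ≤ alexAngle γ σ + alexAngle σ τ := by
  by_contra! h
  set δ := (alexAngle γ τ - (alexAngle γ σ + alexAngle σ τ)) / 3 with hδdef
  have hδ : 0 < δ := by rw [hδdef]; linarith
  have h₁ := alexAngle_nonneg γ σ
  have h₂ := alexAngle_nonneg σ τ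
  have h₃ := alexAngle_le_pi γ τ
  set α := alexAngle γ σ + δ with hα
  set β := alexAngle σ τ + δ with hβ
  have hlt : α + β < alexAngle γ τ := by linarith
  obtain ⟨η₁, hη₁, H₁⟩ := exists_forall_compAngle_lt (show alexAngle γ σ < α by linarith)
  obtain ⟨η₂, hη₂, H₂⟩ := exists_forall_compAngle_lt (show alexAngle σ τ < β by linarith)
  obtain ⟨a, ⟨ha, ha'⟩, b, ⟨hb, hb'⟩, hab⟩ := exists_lt_compAngle hlt (lt_min hη₁ hη₂)
  obtain ⟨t, ht, htm, u, v, hu, hv, hu2, hv2, huv⟩ := exists_split_triangle ha hb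
    (show 0 < α by linarith) (show 0 < β by linarith) (by linarith)
  have ht' : t < min η₁ η₂ := htm.trans_lt (max_lt ha' hb')
  rw [lt_min_iff] at ha' hb' ht'
  have d₁ := sq_lt_of_compAngle_lt ha ht (by linarith) (by linarith)
    (H₁ a ⟨ha, ha'.1⟩ t ⟨ht, ht'.1⟩)
  have d₂ := sq_lt_of_compAngle_lt ht hb (by linarith) (by linarith)
    (H₂ t ⟨ht, ht'.2⟩ b ⟨hb, hb'.2⟩)
  have d₃ := lt_sq_of_lt_compAngle ha hb (by linarith) (by linarith) hab
  rw [← hu2] at d₁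
  rw [← hv2] at d₂
  rw [← huv] at d₃
  have e₁ := lt_of_pow_lt_pow_left₀ 2 hu d₁
  have e₂ := lt_of_pow_lt_pow_left₀ 2 hv d₂
  have e₃ := lt_of_pow_lt_pow_left₀ 2 dist_nonneg d₃
  linarith [dist_triangle (γ a) (σ t) (τ b)]

/-- In a CAT(0) space, Alexandrov angles are at most comparison angles. -/
theorem CAT0.alexAngle_le_compAngle (hX : CAT0 X) {γ σ : ℝ → X} {b c : ℝ} (hb : 0 < b)
    (hc : 0 < c) (hγ : IsGeodesicOn γ 0 b) (hσ : IsGeodesicOn σ 0 c) (h₀ : γ 0 = σ 0) :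
    alexAngle γ σ ≤ compAngle b c (dist (γ b) (σ c)) := by
  refine limsup_le_of_le (isBoundedUnder_ge_compAngle γ σ _).isCoboundedUnder_le ?_
  have hbasis := (Ioo_mem_nhdsGT hb : Ioo 0 b ∈ nhdsWithin (0 : ℝ) (Ioi 0))
  have hbasis' := (Ioo_mem_nhdsGT hc : Ioo 0 c ∈ nhdsWithin (0 : ℝ) (Ioi 0))
  filter_upwards [prod_mem_prod hbasis hbasis']
  rintro ⟨s, t⟩ ⟨⟨hs, hsb⟩, ⟨ht, htc⟩⟩
  simp only at hs hsb ht htc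
  have S₁ := hX.stewart hb hγ (σ t) ⟨hs.le, hsb.le⟩
  have S₂ := hX.stewart hc hσ (γ b) ⟨ht.le, htc.le⟩
  rw [dist_comm (σ t) (γ s), dist_comm (σ t) (γ 0), dist_comm (σ t) (γ b), h₀,
    hσ.dist_zero ⟨ht.le, htc.le⟩] at S₁
  rw [dist_comm (γ b) (σ 0), ← h₀, hγ.dist_zero ⟨hb.le, le_rfl⟩] at S₂
  refine Real.arccos_le_arccos ?_
  have S₃ := mul_le_mul_of_nonneg_left S₂ (show 0 ≤ s / b by positivity)
  have e : s / b * (t / c) * (b ^ 2 + c ^ 2 - dist (γ b) (σ c) ^ 2) ≤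
      s ^ 2 + t ^ 2 - dist (γ s) (σ t) ^ 2 := by
    have id : (1 - s / b) * t ^ 2 + s / b * ((1 - t / c) * b ^ 2 +
        t / c * dist (γ b) (σ c) ^ 2 - t * (c - t)) - s * (b - s) =
        s ^ 2 + t ^ 2 - s / b * (t / c) * (b ^ 2 + c ^ 2 - dist (γ b) (σ c) ^ 2) := by
      field_simp
      ring
    linarith
  rw [le_div_iff₀ (by positivity)]
  refine le_trans (le_of_eq ?_) e
  field_simp

/-- The angle sum of a geodesic triangle in a CAT(0) space is at most `π`. -/
theorem CAT0.angle_sum_le_pi (hX : CAT0 X) {γ σ τ : ℝ → X} {a b c : ℝ} (ha : 0 < a)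
    (hb : 0 < b) (hc : 0 < c) (hγ : IsGeodesicOn γ 0 a) (hσ : IsGeodesicOn σ 0 b)
    (hτ : IsGeodesicOn τ 0 c) (h₁ : γ 0 = τ 0) (h₂ : γ a = σ 0) (h₃ : σ b = τ c) :
    alexAngle γ τ + alexAngle (fun s => γ (a - s)) σ +
      alexAngle (fun s => σ (b - s)) (fun s => τ (c - s)) ≤ Real.pi := by
  have A₁ := hX.alexAngle_le_compAngle ha hc hγ hτ h₁
  have A₂ := hX.alexAngle_le_compAngle ha hb hγ.reverse hσ (by simpa using h₂)
  have A₃ := hX.alexAngle_le_compAngle hb hc hσ.reverse hτ.reverse (by simpa using h₃)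
  have da := hγ.dist_zero ⟨ha.le, le_rfl⟩
  have db := hσ.dist_zero ⟨hb.le, le_rfl⟩
  have dc := hτ.dist_zero ⟨hc.le, le_rfl⟩
  simp only [sub_self] at A₂ A₃
  rw [← h₃, h₂, db] at A₁
  rw [h₁, h₃, dc] at A₂
  rw [← h₂, ← h₁, dist_comm, da] at A₃
  rw [h₁, h₂] at da
  rw [h₃] at db
  have T := compAngle_add_add_le_pi ha hb hc
    (by linarith [dist_triangle (τ 0) (σ 0) (τ c)])
    (by linarith [dist_triangle (τ 0) (τ c) (σ 0), dist_comm (τ c) (σ 0)])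
    (by linarith [dist_triangle (σ 0) (τ 0) (τ c), dist_comm (σ 0) (τ 0)])
  linarith

theorem CAT0.alexAngle_eq_zero (hX : CAT0 X) {γ σ : ℝ → X} {a : ℝ} (ha : 0 < a)
    (hγ : IsGeodesicOn γ 0 a) (hσ : IsGeodesicOn σ 0 a) (h₀ : γ 0 = σ 0) (h₁ : γ a = σ a) :
    alexAngle γ σ = 0 := by
  refine le_antisymm ?_ (alexAngle_nonneg _ _)
  have := hX.alexAngle_le_compAngle ha ha hγ hσ h₀
  rwa [h₁, dist_self, compAngle_self_zero ha] at this

/-- Replacing two sides `γ`, `σ` of a geodesic triangle by the third side `τ` changes the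
directions at the endpoints by less than the defect from `π` of the angle between `γ` and `σ`. -/
theorem CAT0.dist_pos_and_angle_add_angle_lt (hX : CAT0 X) {γ σ : ℝ → X} {a b θ : ℝ}
    (ha : 0 < a) (hb : 0 < b) (hθ : θ ≤ Real.pi) (hγ : IsGeodesicOn γ 0 a)
    (hσ : IsGeodesicOn σ 0 b) (h : γ a = σ 0)
    (hang : Real.pi - θ < alexAngle (fun s => γ (a - s)) σ) :
    0 < dist (γ 0) (σ b) ∧ ∀ τ : ℝ → X, GeodesicFromTo τ (γ 0) (σ b) →
      alexAngle γ τ + alexAngle (fun s => σ (b - s)) (fun s => τ (dist (γ 0) (σ b) - s)) < θ := by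
  have hpos : 0 < dist (γ 0) (σ b) := by
    refine dist_pos.2 fun heq => ?_
    have hab : a = b := by
      rw [← hγ.dist_zero ⟨ha.le, le_rfl⟩, ← hσ.dist_zero ⟨hb.le, le_rfl⟩, heq, h, dist_comm]
    subst hab
    rw [hX.alexAngle_eq_zero ha hγ.reverse hσ (by simpa using h) (by simpa using heq)] at hang
    linarith
  refine ⟨hpos, fun τ ⟨hτ₀, hτ₁, hτ⟩ => ?_⟩
  linarith [hX.angle_sum_le_pi ha hb hpos hγ hσ hτ hτ₀.symm h hτ₁.symm]

end Angle

/-- Ballmann–Brin approximation: if `ω = ω₀⋯ω_{m-1}` is a concatenation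
of geodesics meeting at Alexandrov angles `> π − ε` (ε small), then the geodesic `γ`
joining its endpoints starts (resp. ends) at angle `< (m−1)ε` from the starting
direction of `ω₀` (resp. the ending direction of `ω_{m-1}`). -/
theorem stmt_12 {X : Type*} [MetricSpace X] (hX : CAT0 X)
    (m : ℕ) (hm : 2 ≤ m) (ε : ℝ) (hε : 0 < ε)
    (hsmall : ((m : ℝ) - 1) * ε ≤ Real.pi)
    (ω : ℕ → ℝ → X) (L : ℕ → ℝ) (hL : ∀ i < m, 0 < L i)
    (hgeo : ∀ i < m, IsGeodesicOn (ω i) 0 (L i))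
    (hconn : ∀ i, i + 1 < m → ω i (L i) = ω (i + 1) 0)
    (hang : ∀ i, i + 1 < m →
      Real.pi - ε < alexAngle (fun s => ω i (L i - s)) (ω (i + 1)))
    (γ : ℝ → X) (hγ : GeodesicFromTo γ (ω 0 0) (ω (m - 1) (L (m - 1)))) :
    alexAngle (ω 0) γ < ((m : ℝ) - 1) * ε ∧
    alexAngle (fun s => ω (m - 1) (L (m - 1) - s))
        (fun s => γ (dist (ω 0 0) (ω (m - 1) (L (m - 1))) - s)) <
      ((m : ℝ) - 1) * ε := by
  have key : ∀ k, k < m → 0 < dist (ω 0 0) (ω k (L k)) ∧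
      ∀ γ : ℝ → X, GeodesicFromTo γ (ω 0 0) (ω k (L k)) →
        alexAngle (ω 0) γ + alexAngle (fun s => ω k (L k - s))
          (fun s => γ (dist (ω 0 0) (ω k (L k)) - s)) ≤ k * ε ∧
        (k ≠ 0 → alexAngle (ω 0) γ + alexAngle (fun s => ω k (L k - s))
          (fun s => γ (dist (ω 0 0) (ω k (L k)) - s)) < k * ε) := by
    intro k
    induction k with
    | zero =>
      intro h
      have hL0 := hL 0 h
      have hg := hgeo 0 h
      rw [hg.dist_zero ⟨hL0.le, le_rfl⟩]
      refine ⟨hL0, fun γ ⟨h₀, h₁, hγ⟩ => ⟨?_, fun h => absurd rfl h⟩⟩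
      rw [hg.dist_zero ⟨hL0.le, le_rfl⟩] at h₁ hγ
      rw [hX.alexAngle_eq_zero hL0 hg hγ h₀.symm h₁.symm,
        hX.alexAngle_eq_zero hL0 hg.reverse hγ.reverse (by simpa using h₁.symm)
          (by simpa using h₀.symm)]
      simp
    | succ k ih =>
      intro hk
      obtain ⟨hpos, ih⟩ := ih (by omega)
      obtain ⟨σ, hσ⟩ := hX.1 (ω 0 0) (ω k (L k))
      have hle := (ih σ hσ).1
      obtain ⟨hσ₀, hσ₁, hσ⟩ := hσ
      set α := alexAngle (ω 0) σ with hα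
      set β := alexAngle (fun s => ω k (L k - s))
        (fun s => σ (dist (ω 0 0) (ω k (L k)) - s)) with hβ
      have hα0 : 0 ≤ α := alexAngle_nonneg _ _
      have hkm : ((k : ℝ) + 1) * ε ≤ Real.pi := by
        refine le_trans (mul_le_mul_of_nonneg_right ?_ hε.le) hsmall
        have : ((k + 1 + 1 : ℕ) : ℝ) ≤ m := by exact_mod_cast hk
        push_cast at this
        linarith
      have htri := alexAngle_triangle (fun s => ω k (L k - s))
        (fun s => σ (dist (ω 0 0) (ω k (L k)) - s)) (ω (k + 1))
      have hbreak := hang k hk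
      obtain ⟨hpos', H⟩ := hX.dist_pos_and_angle_add_angle_lt (θ := ε + β) hpos (hL _ hk)
        (by linarith) hσ (hgeo _ hk) (hσ₁.trans (hconn k hk)) (by linarith)
      rw [hσ₀] at hpos' H
      refine ⟨hpos', fun τ hτ => ?_⟩
      have hlt := H τ hτ
      have htri' := alexAngle_triangle (ω 0) σ τ
      have hfin : alexAngle (ω 0) τ + alexAngle (fun s => ω (k + 1) (L (k + 1) - s))
          (fun s => τ (dist (ω 0 0) (ω (k + 1) (L (k + 1))) - s)) < ((k + 1 : ℕ) : ℝ) * ε := by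
        push_cast
        linarith
      exact ⟨hfin.le, fun _ => hfin⟩
  have hlt := ((key (m - 1) (by omega)).2 γ hγ).2 (by omega)
  rw [Nat.cast_sub (by omega), Nat.cast_one] at hlt
  have h₁ := alexAngle_nonneg (ω 0) γ
  have h₂ := alexAngle_nonneg (fun s => ω (m - 1) (L (m - 1) - s))
    (fun s => γ (dist (ω 0 0) (ω (m - 1) (L (m - 1))) - s))
  exact ⟨by linarith, by linarith⟩
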